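/- Let Ω ⊂ ℂ^m be open with 1 ≤ m < ∞, and E, F complex Banach spaces. Then every homomorphism of sheaves of O-modules φ : O^E → O^F over Ω is induced by a holomorphic map Φ : Ω → Hom(E,F), i.e., for each open U ⊂ Ω, ζ ∈ U and holomorphic e : U → E, φ sends the germ e_ζ to the germ at ζ of z ↦ Φ(z)e(z). -/

import Mathlib

open Filter Topology Metric

/-- Cauchy's estimate for the Fréchet derivative. -/
theorem norm_fderiv_le_of_norm_le_closedBall {V G : Type*}
    [NormedAddCommGroup V] [NormedSpace ℂ V] [NormedAddCommGroup G] [NormedSpace ℂ G]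
    {g : V → G} {z : V} {r M : ℝ} (hr : 0 < r) (hg : DifferentiableOn ℂ g (closedBall z r))
    (hM : ∀ w ∈ closedBall z r, ‖g w‖ ≤ M) : ‖fderiv ℂ g z‖ ≤ M / r := by
  have hM0 : 0 ≤ M := (norm_nonneg _).trans (hM z (mem_closedBall_self hr.le))
  refine ContinuousLinearMap.opNorm_le_bound _ (by positivity) fun v => ?_
  rcases eq_or_ne v 0 with rfl | hv
  · simp
  have hv' : 0 < ‖v‖ := norm_pos_iff.2 hv
  have hmaps : Set.MapsTo (fun t : ℂ => z + t • v) (closedBall 0 (r / ‖v‖)) (closedBall z r) := by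
    intro t ht
    rw [mem_closedBall_zero_iff, le_div_iff₀ hv'] at ht
    simpa [norm_smul] using ht
  have hline : Differentiable ℂ fun t : ℂ => z + t • v := by fun_prop
  have hdiff : DifferentiableOn ℂ (fun t : ℂ => g (z + t • v)) (closedBall 0 (r / ‖v‖)) :=
    hg.comp hline.differentiableOn hmaps
  have hderiv : deriv (fun t : ℂ => g (z + t • v)) 0 = fderiv ℂ g z v := by
    have hgz : HasFDerivAt g (fderiv ℂ g z) (z + (0 : ℂ) • v) := by
      simpa using (hg.differentiableAt (closedBall_mem_nhds z hr)).hasFDerivAt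
    have hl : HasDerivAt (fun t : ℂ => z + t • v) v 0 := by
      simpa using ((hasDerivAt_id (0 : ℂ)).smul_const v).const_add z
    exact (hgz.comp_hasDerivAt (0 : ℂ) hl).deriv
  have h := Complex.norm_deriv_le_of_forall_mem_sphere_norm_le (div_pos hr hv')
    (hdiff.diffContOnCl_ball subset_rfl)
    (fun t ht => hM _ (hmaps (sphere_subset_closedBall ht)))
  rw [hderiv] at h
  refine h.trans (le_of_eq ?_)
  field_simp

/-- Cauchy's estimates for the iterated Fréchet derivatives at the centre of a ball. -/
theorem norm_iteratedFDeriv_le_of_norm_le_ball {V : Type} [NormedAddCommGroup V] [NormedSpace ℂ V]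
    {r : ℝ} (hr : 0 < r) (n : ℕ) :
    ∀ {G : Type*} [NormedAddCommGroup G] [NormedSpace ℂ G] [CompleteSpace G]
    {g : V → G} {ζ : V} {R M : ℝ}, n * r < R → AnalyticOnNhd ℂ g (ball ζ R) →
    (∀ w ∈ ball ζ R, ‖g w‖ ≤ M) → ‖iteratedFDeriv ℂ n g ζ‖ ≤ M / r ^ n := by
  induction n with
  | zero =>
    intro G _ _ _ g ζ R M hR _ hM
    simpa using hM ζ (mem_ball_self (by simpa using hR))
  | succ n ih =>
    intro G _ _ _ g ζ R M hR hg hM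
    push_cast at hR
    have hsub : ball ζ (R - r) ⊆ ball ζ R := ball_subset_ball (by linarith)
    have hcl : ∀ w ∈ ball ζ (R - r), closedBall w r ⊆ ball ζ R := fun w hw =>
      closedBall_subset_ball' (by rw [mem_ball] at hw; linarith)
    have h := ih (g := fderiv ℂ g) (ζ := ζ) (R := R - r) (M := M / r) (by linarith)
      (hg.fderiv.mono hsub) fun w hw =>
        norm_fderiv_le_of_norm_le_closedBall hr (hg.differentiableOn.mono (hcl w hw))
          fun u hu => hM u (hcl w hw hu)
    rw [norm_iteratedFDeriv_fderiv] at h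
    refine h.trans (le_of_eq ?_)
    rw [pow_succ', div_div]

/-- A locally bounded operator-valued map that is holomorphic in the strong sense is holomorphic
for the operator norm. -/
theorem analyticAt_of_forall_apply_of_norm_le {V : Type} [NormedAddCommGroup V] [NormedSpace ℂ V]
    {E F : Type*} [NormedAddCommGroup E] [NormedSpace ℂ E]
    [NormedAddCommGroup F] [NormedSpace ℂ F] [CompleteSpace F]
    {Φ : V → E →L[ℂ] F} {ζ : V} {R M : ℝ} (hR : 0 < R)
    (hΦ : ∀ e, AnalyticOnNhd ℂ (fun z => Φ z e) (ball ζ R))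
    (hM : ∀ z ∈ ball ζ R, ‖Φ z‖ ≤ M) : AnalyticAt ℂ Φ ζ := by
  have hM0 : 0 ≤ M := (norm_nonneg _).trans (hM ζ (mem_ball_self hR))
  have hζ : ζ ∈ ball ζ R := mem_ball_self hR
  have hbound : ∀ (n : ℕ) (e : E), ‖iteratedFDeriv ℂ n (fun z => Φ z e) ζ‖ ≤
      M / (R / (n + 1)) ^ n * ‖e‖ := by
    intro n e
    have h := norm_iteratedFDeriv_le_of_norm_le_ball (r := R / (n + 1)) (R := R) (M := M * ‖e‖)
      (by positivity) n (by rw [← mul_div_assoc, div_lt_iff₀ (by positivity)]; nlinarith) (hΦ e)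
      (fun w hw => (Φ w).le_of_opNorm_le (hM w hw) e)
    refine h.trans (le_of_eq ?_)
    ring
  let D : ∀ n : ℕ, E →L[ℂ] (V [×n]→L[ℂ] F) := fun n =>
    LinearMap.mkContinuous
      { toFun := fun e => iteratedFDeriv ℂ n (fun z => Φ z e) ζ
        map_add' := fun e e' => by
          simp only [map_add]
          exact fun_iteratedFDeriv_add_apply (hΦ e ζ hζ).contDiffAt (hΦ e' ζ hζ).contDiffAt
        map_smul' := fun c e => by
          simp only [map_smul, RingHom.id_apply]
          exact iteratedFDeriv_const_smul_apply' (hΦ e ζ hζ).contDiffAt }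
      (M / (R / (n + 1)) ^ n) (hbound n)
  have hD : ∀ n, ‖D n‖ ≤ M / (R / (n + 1)) ^ n := fun n =>
    LinearMap.mkContinuous_norm_le _ (by positivity) _
  let p : FormalMultilinearSeries ℂ V (E →L[ℂ] F) := fun n =>
    ((n.factorial : ℂ)⁻¹) • (D n).flipMultilinear
  have hp : ∀ n, ‖p n‖ ≤ (n.factorial : ℝ)⁻¹ * (M / (R / (n + 1)) ^ n) := by
    intro n
    have h1 : ‖(D n).flipMultilinear‖ ≤ ‖D n‖ :=
      MultilinearMap.mkContinuous_norm_le _ (norm_nonneg _) _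
    calc ‖p n‖ ≤ ‖(n.factorial : ℂ)⁻¹‖ * ‖(D n).flipMultilinear‖ :=
          ContinuousMultilinearMap.opNorm_smul_le _ _
      _ = (n.factorial : ℝ)⁻¹ * ‖(D n).flipMultilinear‖ := by simp
      _ ≤ _ := by gcongr; exact h1.trans (hD n)
  obtain ⟨ρ, hρ⟩ : ∃ ρ : NNReal, (ρ : ℝ) = R / Real.exp 1 := ⟨⟨_, by positivity⟩, rfl⟩
  have hρ0 : (0 : ℝ) < ρ := by rw [hρ]; positivity
  have hρR : (ρ : ℝ) ≤ R := by
    rw [hρ]; exact div_le_self hR.le (Real.one_le_exp zero_le_one)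
  have hrad : (ρ : ENNReal) ≤ p.radius := by
    refine p.le_radius_of_bound (M * Real.exp 1) fun n => ?_
    have hexp := Real.pow_div_factorial_le_exp (x := (n : ℝ) + 1) (by positivity) n
    have hpow : Real.exp ((n : ℝ) + 1) = Real.exp 1 ^ n * Real.exp 1 := by
      rw [Real.exp_add, ← Real.exp_nat_mul, mul_one]
    rw [hpow] at hexp
    calc ‖p n‖ * (ρ : ℝ) ^ n
        ≤ (n.factorial : ℝ)⁻¹ * (M / (R / (n + 1)) ^ n) * (ρ : ℝ) ^ n := by gcongr; exact hp n
      _ = M * (((n : ℝ) + 1) ^ n / n.factorial) / Real.exp 1 ^ n := by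
          rw [hρ, div_pow, div_pow]; field_simp
      _ ≤ M * (Real.exp 1 ^ n * Real.exp 1) / Real.exp 1 ^ n := by gcongr
      _ = M * Real.exp 1 := by field_simp
  have hrad0 : 0 < p.radius := lt_of_lt_of_le (by exact_mod_cast hρ0) hrad
  have hps : HasFPowerSeriesOnBall (fun z => p.sum (z - ζ)) p ζ p.radius := by
    simpa using (p.hasFPowerSeriesOnBall hrad0).comp_sub ζ
  refine hps.analyticAt.congr ?_
  have hball : ball ζ (ρ : ℝ) ∈ 𝓝 ζ := ball_mem_nhds _ hρ0
  filter_upwards [hball] with z hz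
  ext e
  have hS : AnalyticOnNhd ℂ (fun z => p.sum (z - ζ) e) (ball ζ (ρ : ℝ)) := by
    intro w hw
    have hw' : w ∈ Metric.eball ζ p.radius := by
      refine Metric.eball_subset_eball hrad ?_
      rwa [Metric.eball_coe]
    exact ((ContinuousLinearMap.apply ℂ F e).analyticAt _).comp (hps.analyticOnNhd w hw')
  refine hS.eqOn_of_preconnected_of_eventuallyEq
    ((hΦ e).mono (ball_subset_ball hρR)) (convex_ball ζ (ρ : ℝ)).isPreconnected
    (mem_ball_self hρ0) ?_ hz
  obtain ⟨q, r, hq⟩ := hΦ e ζ hζ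
  filter_upwards [Metric.eball_mem_nhds ζ hq.r_pos, Metric.eball_mem_nhds ζ hrad0] with w hw hw'
  have h1 := hq.hasSum_iteratedFDeriv (y := w - ζ) (by simpa [edist_eq_enorm_sub] using hw)
  have h2 := hps.hasSum (y := w - ζ) (by simpa [edist_eq_enorm_sub] using hw')
  have h3 := (ContinuousLinearMap.apply ℂ F e).hasSum h2
  rw [add_sub_cancel] at h1 h3
  exact h3.unique h1

/-- First-order Taylor formula with an analytic remainder coefficient. -/
theorem AnalyticAt.exists_eq_add_apply_sub {V E : Type*} [NormedAddCommGroup V] [NormedSpace ℂ V]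
    [NormedAddCommGroup E] [NormedSpace ℂ E] [CompleteSpace E] {f : V → E} {ζ : V}
    (hf : AnalyticAt ℂ f ζ) :
    ∃ g : V → V →L[ℂ] E, AnalyticAt ℂ g ζ ∧ ∀ᶠ z in 𝓝 ζ, f z = f ζ + g z (z - ζ) := by
  obtain ⟨p, r, hp⟩ := hf
  have hrad : 0 < p.shift.radius := by
    rw [p.radius_shift]; exact hp.r_pos.trans_le hp.r_le
  have hq : HasFPowerSeriesOnBall (fun z => p.shift.sum (z - ζ)) p.shift ζ p.shift.radius := by
    simpa using (p.shift.hasFPowerSeriesOnBall hrad).comp_sub ζ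
  refine ⟨_, hq.analyticAt, ?_⟩
  filter_upwards [Metric.eball_mem_nhds ζ hp.r_pos, Metric.eball_mem_nhds ζ hrad] with z hz hz'
  have h1 := hp.hasSum (y := z - ζ) (by simpa [edist_eq_enorm_sub] using hz)
  have h2 := (hq.unshift (z := f ζ)).hasSum (y := z - ζ)
    (by simpa [edist_eq_enorm_sub] using hz')
  rw [add_sub_cancel] at h1 h2
  refine h1.unique ?_
  convert! h2 using 2 with n
  cases n with
  | zero => simpa [FormalMultilinearSeries.unshift] using hp.coeff_zero _
  | succ n => simp [FormalMultilinearSeries.unshift, FormalMultilinearSeries.shift]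

/-- The `N`-th derivative at `0` of `t ↦ t ^ N • k t`. -/
theorem iteratedDeriv_pow_smul_zero {F : Type*} [NormedAddCommGroup F] [NormedSpace ℂ F]
    [CompleteSpace F] (N : ℕ) {k : ℂ → F} (hk : AnalyticAt ℂ k 0) :
    iteratedDeriv N (fun t => t ^ N • k t) 0 = (N.factorial : ℂ) • k 0 := by
  induction N generalizing k with
  | zero => simp
  | succ N ih =>
    have hev : deriv (fun t => t ^ (N + 1) • k t) =ᶠ[𝓝 0]
        fun t => t ^ N • (((N : ℂ) + 1) • k t + t • deriv k t) := by
      filter_upwards [hk.eventually_analyticAt] with t ht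
      have h := ((hasDerivAt_pow (N + 1) t).smul ht.differentiableAt.hasDerivAt).deriv
      refine Eq.trans h ?_
      simp only [Nat.cast_add, Nat.cast_one, Nat.add_sub_cancel]
      module
    have hk' : AnalyticAt ℂ (fun t => ((N : ℂ) + 1) • k t + t • deriv k t) 0 :=
      (analyticAt_const.smul hk).add (analyticAt_id.smul hk.deriv)
    rw [iteratedDeriv_succ', hev.iteratedDeriv_eq, ih hk', Nat.factorial_succ]
    simp only [zero_smul, add_zero, smul_smul]
    push_cast
    congr 1
    ring

/-- Recursive choice of a sequence whose `N`-th term is constrained by the earlier terms. -/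
theorem exists_seq_of_forall_exists_of_congr {α : Type*} [Nonempty α]
    {P : ℕ → (ℕ → α) → α → Prop} (hex : ∀ N u, ∃ x, P N u x)
    (hcongr : ∀ N u v x, (∀ n < N, u n = v n) → P N u x → P N v x) :
    ∃ u : ℕ → α, ∀ N, P N u (u N) := by
  classical
  choose c hc using hex
  let a : α := Classical.arbitrary α
  let u : ℕ → α := fun N => Nat.strongRec
    (fun n prev => c n fun k => if h : k < n then prev k h else a) N
  have hu : ∀ N, u N = c N fun k => if k < N then u k else a := by
    intro N
    simp only [u]
    rw [Nat.strongRec_eq]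
    simp
  refine ⟨u, fun N => ?_⟩
  rw [hu N]
  exact hcongr N _ _ _ (fun n hn => by simp [hn]) (hc N _)

/-- Power series with coefficients in the unit ball are summable on the open unit disc. -/
theorem summable_pow_smul_of_norm_le_one {E : Type*} [NormedAddCommGroup E] [NormedSpace ℂ E]
    [CompleteSpace E] {u : ℕ → E} (hu : ∀ n, ‖u n‖ ≤ 1) {t : ℂ} (ht : ‖t‖ < 1) :
    Summable fun n => t ^ n • u n := by
  refine Summable.of_norm_bounded (summable_geometric_of_lt_one (norm_nonneg t) ht) fun n => ?_
  rw [norm_smul, norm_pow]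
  exact mul_le_of_le_one_right (by positivity) (hu n)

/-- A power series with coefficients in the unit ball is analytic at `0`. -/
theorem analyticAt_tsum_pow_smul {E : Type*} [NormedAddCommGroup E] [NormedSpace ℂ E]
    [CompleteSpace E] {u : ℕ → E} (hu : ∀ n, ‖u n‖ ≤ 1) :
    AnalyticAt ℂ (fun t : ℂ => ∑' n, t ^ n • u n) 0 := by
  have h : DifferentiableOn ℂ (fun t : ℂ => ∑' n, t ^ n • u n) (ball 0 (1 / 2)) := by
    refine Complex.differentiableOn_tsum_of_summable_norm
      (summable_geometric_of_lt_one (r := 1 / 2) (by norm_num) (by norm_num))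
      (fun n => by fun_prop) isOpen_ball fun n t ht => ?_
    rw [mem_ball_zero_iff] at ht
    rw [norm_smul, norm_pow]
    exact (mul_le_of_le_one_right (by positivity) (hu n)).trans (by gcongr)
  exact h.analyticAt (ball_mem_nhds _ (by norm_num))

/-- If a one-parameter family of linear maps sends analytic germs at `0` to analytic germs at `0`,
then its member at `0` is bounded. -/
theorem exists_norm_apply_le_of_analyticAt {E F : Type*} [NormedAddCommGroup E] [NormedSpace ℂ E]
    [CompleteSpace E] [NormedAddCommGroup F] [NormedSpace ℂ F] [CompleteSpace F]
    {A : ℂ → E →ₗ[ℂ] F}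
    (hA : ∀ s : ℂ → E, AnalyticAt ℂ s 0 → AnalyticAt ℂ (fun t => A t (s t)) 0) :
    ∃ C, ∀ e, ‖A 0 e‖ ≤ C * ‖e‖ := by
  by_contra! hunb
  have hlarge : ∀ K : ℝ, ∃ e, ‖e‖ ≤ 1 ∧ K ≤ ‖A 0 e‖ := by
    intro K
    obtain ⟨e, he⟩ := hunb K
    have he0 : 0 < ‖e‖ := by
      rw [norm_pos_iff]; rintro rfl; simp at he
    refine ⟨((‖e‖ : ℂ)⁻¹) • e, ?_, ?_⟩
    · rw [norm_smul]; simp [he0.ne']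
    · rw [map_smul, norm_smul, norm_inv, Complex.norm_real, norm_norm, ← div_eq_inv_mul,
        le_div_iff₀ he0]
      exact he.le
  -- the contribution of the first `N` coefficients to the `N`-th derivative
  let c : ℕ → (ℕ → E) → F := fun N u =>
    iteratedDeriv N (fun t => ∑ n ∈ Finset.range N, t ^ n • A t (u n)) 0
  obtain ⟨u, hu⟩ := exists_seq_of_forall_exists_of_congr
    (P := fun N u x => ‖x‖ ≤ 1 ∧
      (N.factorial : ℝ) * (N : ℝ) ^ N ≤ ‖(N.factorial : ℂ) • A 0 x + c N u‖)
    (fun N u => by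
      obtain ⟨e, he, he'⟩ := hlarge ((N : ℝ) ^ N + ‖c N u‖)
      refine ⟨e, he, ?_⟩
      have h1 : (1 : ℝ) ≤ N.factorial := by exact_mod_cast N.factorial_pos
      have h2 := norm_sub_le_norm_add ((N.factorial : ℂ) • A 0 e) (c N u)
      rw [norm_smul, Complex.norm_natCast] at h2
      nlinarith [norm_nonneg (c N u)])
    (fun N u v x huv hx => by
      have : c N u = c N v := by
        simp only [c]
        congr 1
        ext t
        exact Finset.sum_congr rfl fun n hn => by rw [huv n (Finset.mem_range.1 hn)]
      simpa only [this] using hx)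
  let s : ℕ → ℂ → E := fun N t => ∑' n, t ^ n • u (n + N)
  have hs : ∀ N, AnalyticAt ℂ (s N) 0 := fun N => analyticAt_tsum_pow_smul fun n => (hu _).1
  have hs0 : ∀ N, s N 0 = u N := by
    intro N
    simp only [s]
    rw [tsum_eq_single 0 (fun n hn => by simp [hn])]
    simp
  have hsplit : ∀ N, ∀ t : ℂ, ‖t‖ < 1 →
      s 0 t = ∑ n ∈ Finset.range N, t ^ n • u n + t ^ N • s N t := by
    intro N t ht
    have hsum := summable_pow_smul_of_norm_le_one (fun n => (hu n).1) ht
    simp only [s, add_zero]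
    rw [← hsum.sum_add_tsum_nat_add N]
    congr 1
    rw [← Summable.tsum_const_smul _
      (summable_pow_smul_of_norm_le_one (fun n => (hu (n + N)).1) ht)]
    simp only [smul_smul, ← pow_add, add_comm N]
  have hderiv : ∀ N, iteratedDeriv N (fun t => A t (s 0 t)) 0 =
      (N.factorial : ℂ) • A 0 (u N) + c N u := by
    intro N
    have hev : (fun t => A t (s 0 t)) =ᶠ[𝓝 0] fun t =>
        t ^ N • A t (s N t) + ∑ n ∈ Finset.range N, t ^ n • A t (u n) := by
      filter_upwards [ball_mem_nhds (0 : ℂ) one_pos] with t ht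
      rw [hsplit N t (by simpa using ht)]
      simp [map_sum, add_comm]
    have h1 : AnalyticAt ℂ (fun t : ℂ => t ^ N • A t (s N t)) 0 :=
      (analyticAt_id.pow N).smul (hA _ (hs N))
    have h2 : AnalyticAt ℂ (fun t : ℂ => ∑ n ∈ Finset.range N, t ^ n • A t (u n)) 0 :=
      Finset.analyticAt_fun_sum _ fun n _ =>
        (analyticAt_id.pow n).smul (hA (fun _ => u n) analyticAt_const)
    rw [hev.iteratedDeriv_eq, iteratedDeriv_fun_add h1.contDiffAt h2.contDiffAt,
      iteratedDeriv_pow_smul_zero N (hA _ (hs N)), hs0]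
  obtain ⟨r, hr, hball⟩ := Metric.eventually_nhds_iff_ball.1 (hA _ (hs 0)).eventually_analyticAt
  have hcb : closedBall (0 : ℂ) (r / 2) ⊆ ball 0 r := closedBall_subset_ball (by linarith)
  have hdiff : DifferentiableOn ℂ (fun t => A t (s 0 t)) (closedBall 0 (r / 2)) := fun t ht =>
    (hball t (hcb ht)).differentiableAt.differentiableWithinAt
  obtain ⟨C, hC⟩ := (isCompact_closedBall (0 : ℂ) (r / 2)).exists_bound_of_continuousOn
    hdiff.continuousOn
  have hgrow : ∀ N : ℕ, (N : ℝ) ^ N ≤ C / (r / 2) ^ N := by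
    intro N
    have h1 := Complex.norm_iteratedDeriv_le_of_forall_mem_sphere_norm_le N (half_pos hr)
      (hdiff.diffContOnCl_ball subset_rfl) fun t ht => hC t (sphere_subset_closedBall ht)
    rw [hderiv N] at h1
    have h2 := (hu N).2.trans h1
    rw [mul_div_assoc] at h2
    exact le_of_mul_le_mul_left h2 (by exact_mod_cast N.factorial_pos)
  obtain ⟨N, hN⟩ := exists_nat_gt (max (4 / r) (max C 1))
  have hN1 : 4 / r < N := (le_max_left _ _).trans_lt hN
  have hN2 : C < N := ((le_max_left _ _).trans (le_max_right _ _)).trans_lt hN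
  have h := hgrow N
  rw [le_div_iff₀ (by positivity), ← mul_pow] at h
  rw [div_lt_iff₀ hr] at hN1
  have h2 : (2 : ℝ) ^ N ≤ ((N : ℝ) * (r / 2)) ^ N := by gcongr; linarith
  have h3 : (N : ℝ) < 2 ^ N := by exact_mod_cast Nat.lt_two_pow_self
  linarith

/-- A family of linear maps sending analytic germs to analytic germs, over an open subset of a
nontrivial finite-dimensional space, is a holomorphic family of bounded operators. -/
theorem exists_analyticOnNhd_of_linearMap_family {m : ℕ} (hm : 1 ≤ m)
    {E F : Type*} [NormedAddCommGroup E] [NormedSpace ℂ E] [CompleteSpace E]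
    [NormedAddCommGroup F] [NormedSpace ℂ F] [CompleteSpace F]
    {Ω : Set (Fin m → ℂ)} (hΩ : IsOpen Ω) {L : (Fin m → ℂ) → E →ₗ[ℂ] F}
    (hL : ∀ ζ ∈ Ω, ∀ f : (Fin m → ℂ) → E, AnalyticAt ℂ f ζ →
      AnalyticAt ℂ (fun z => L z (f z)) ζ) :
    ∃ Φ : (Fin m → ℂ) → E →L[ℂ] F, AnalyticOnNhd ℂ Φ Ω ∧ ∀ z ∈ Ω, ∀ e, Φ z e = L z e := by
  classical
  let i₀ : Fin m := ⟨0, hm⟩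
  have hbdd : ∀ ζ ∈ Ω, ∃ C, ∀ e, ‖L ζ e‖ ≤ C * ‖e‖ := by
    intro ζ hζ
    let l : ℂ → Fin m → ℂ := fun t => ζ + t • Pi.single i₀ (1 : ℂ)
    have hl0 : l 0 = ζ := by simp [l]
    have hl : AnalyticAt ℂ l 0 := analyticAt_const.add (analyticAt_id.smul analyticAt_const)
    have hcoord : AnalyticAt ℂ (fun z : Fin m → ℂ => z i₀ - ζ i₀) ζ :=
      ((ContinuousLinearMap.proj (R := ℂ) (φ := fun _ : Fin m => ℂ) i₀).analyticAt ζ).sub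
        analyticAt_const
    have h := exists_norm_apply_le_of_analyticAt (A := fun t => L (l t)) fun s hs => by
      have hf : AnalyticAt ℂ (fun z : Fin m → ℂ => s (z i₀ - ζ i₀)) ζ :=
        AnalyticAt.fun_comp (by simpa using hs) hcoord
      have := AnalyticAt.fun_comp (f := l) (x := (0 : ℂ)) (by rw [hl0]; exact hL ζ hζ _ hf) hl
      simpa [l] using this
    simpa only [hl0] using h
  choose! C hC using hbdd
  let Φ : (Fin m → ℂ) → E →L[ℂ] F := fun z =>
    if hz : z ∈ Ω then (L z).mkContinuous (C z) (hC z hz) else 0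
  have hΦ : ∀ z ∈ Ω, ∀ e, Φ z e = L z e := fun z hz e => by simp [Φ, hz]
  have hΦan : ∀ e, AnalyticOnNhd ℂ (fun z => Φ z e) Ω := fun e z hz =>
    (hL z hz (fun _ => e) analyticAt_const).congr <| by
      filter_upwards [hΩ.mem_nhds hz] with w hw using (hΦ w hw e).symm
  refine ⟨Φ, fun ζ hζ => ?_, hΦ⟩
  obtain ⟨R, hR, hsub⟩ := Metric.nhds_basis_closedBall.mem_iff.1 (hΩ.mem_nhds hζ)
  obtain ⟨M, hM⟩ := banach_steinhaus (g := fun z : closedBall ζ R => Φ z) fun e => by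
    obtain ⟨K, hK⟩ := (isCompact_closedBall ζ R).exists_bound_of_continuousOn
      ((hΦan e).continuousOn.mono hsub)
    exact ⟨K, fun z => hK z z.2⟩
  exact analyticAt_of_forall_apply_of_norm_le hR
    (fun e => (hΦan e).mono (ball_subset_closedBall.trans hsub))
    fun z hz => hM ⟨z, ball_subset_closedBall hz⟩

/-- **Theorem 1.1.** Every homomorphism of sheaves of `O`-modules
`φ : O^E → O^F` over an open `Ω ⊆ ℂ^m`, `1 ≤ m < ∞`, is induced by a holomorphic map
`Φ : Ω → Hom(E,F)`. The sheaf homomorphism is encoded by its action on sections: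
`φ U f` is the section of `O^F` over `U` determined by the section `f` of `O^E` over `U`,
subject to locality, additivity, `O(U)`-linearity and compatibility with restrictions. -/
theorem sheaf_hom_of_plain_sheaves_is_plain
    (m : ℕ) (hm : 1 ≤ m)
    (E F : Type*) [NormedAddCommGroup E] [NormedSpace ℂ E] [CompleteSpace E]
    [NormedAddCommGroup F] [NormedSpace ℂ F] [CompleteSpace F]
    (Ω : Set (Fin m → ℂ)) (hΩ : IsOpen Ω)
    (φ : Set (Fin m → ℂ) → ((Fin m → ℂ) → E) → ((Fin m → ℂ) → F))
    (hanal : ∀ U, U ⊆ Ω → IsOpen U → ∀ f, AnalyticOnNhd ℂ f U →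
      AnalyticOnNhd ℂ (φ U f) U)
    (hlocal : ∀ U, U ⊆ Ω → IsOpen U → ∀ f g, AnalyticOnNhd ℂ f U → AnalyticOnNhd ℂ g U →
      Set.EqOn f g U → Set.EqOn (φ U f) (φ U g) U)
    (hadd : ∀ U, U ⊆ Ω → IsOpen U → ∀ f g, AnalyticOnNhd ℂ f U → AnalyticOnNhd ℂ g U →
      Set.EqOn (φ U (f + g)) (φ U f + φ U g) U)
    (hsmul : ∀ U, U ⊆ Ω → IsOpen U → ∀ (a : (Fin m → ℂ) → ℂ) f, AnalyticOnNhd ℂ a U →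
      AnalyticOnNhd ℂ f U →
      Set.EqOn (φ U (fun z => a z • f z)) (fun z => a z • φ U f z) U)
    (hres : ∀ U, U ⊆ Ω → IsOpen U → ∀ V, V ⊆ U → IsOpen V → ∀ f, AnalyticOnNhd ℂ f U →
      Set.EqOn (φ U f) (φ V f) V) :
    ∃ Φ : (Fin m → ℂ) → (E →L[ℂ] F), AnalyticOnNhd ℂ Φ Ω ∧
      ∀ U, U ⊆ Ω → IsOpen U → ∀ f, AnalyticOnNhd ℂ f U → ∀ z ∈ U, φ U f z = Φ z (f z) := by
  classical
  have hconst : ∀ e : E, AnalyticOnNhd ℂ (fun _ : Fin m → ℂ => e) Ω := fun e _ _ =>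
    analyticAt_const
  -- the value of `φ U f` at a point depends only on the value of `f` there
  have hpoint : ∀ U, U ⊆ Ω → IsOpen U → ∀ f, AnalyticOnNhd ℂ f U → ∀ ζ ∈ U,
      φ U f ζ = φ Ω (fun _ => f ζ) ζ := by
    intro U hU hUo f hf ζ hζ
    obtain ⟨g, hg, hfg⟩ := (hf ζ hζ).exists_eq_add_apply_sub
    obtain ⟨W, hW, hWo, hζW⟩ := _root_.eventually_nhds_iff.1
      ((hg.eventually_analyticAt.and hfg).and (hUo.mem_nhds hζ))
    have hWU : W ⊆ U := fun z hz => (hW z hz).2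
    have hWΩ := hWU.trans hU
    let a : Fin m → (Fin m → ℂ) → ℂ := fun i z => z i - ζ i
    let b : Fin m → (Fin m → ℂ) → E := fun i z => g z (Pi.single i 1)
    have ha : ∀ i, AnalyticOnNhd ℂ (a i) W := fun i z _ =>
      ((ContinuousLinearMap.proj (R := ℂ) (φ := fun _ : Fin m => ℂ) i).analyticAt z).sub
        analyticAt_const
    have hb : ∀ i, AnalyticOnNhd ℂ (b i) W := fun i z hz =>
      ((ContinuousLinearMap.apply ℂ E (Pi.single i (1 : ℂ) : Fin m → ℂ)).analyticAt _).comp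
        (hW z hz).1.1
    have hab : ∀ i, AnalyticOnNhd ℂ (fun z => a i z • b i z) W := fun i => (ha i).smul (hb i)
    have hsan : ∀ s : Finset (Fin m), AnalyticOnNhd ℂ (fun z => ∑ i ∈ s, a i z • b i z) W :=
      fun s z hz => Finset.analyticAt_fun_sum s fun i _ => hab i z hz
    have hsum : ∀ s : Finset (Fin m), φ W (fun z => ∑ i ∈ s, a i z • b i z) ζ = 0 := by
      intro s
      induction s using Finset.induction_on with
      | empty =>
        have h := hsmul W hWΩ hWo (fun _ => 0) (fun _ => 0) (fun _ _ => analyticAt_const)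
          (fun _ _ => analyticAt_const) hζW
        simpa using h
      | insert i s hi ih =>
        have h := hadd W hWΩ hWo _ _ (hab i) (hsan s) hζW
        have h' := hsmul W hWΩ hWo _ _ (ha i) (hb i) hζW
        simp only [Finset.sum_insert hi]
        refine h.trans ?_
        rw [Pi.add_apply, ih, h']
        simp [a]
    have heq : Set.EqOn f ((fun _ => f ζ) + fun z => ∑ i, a i z • b i z) W := by
      intro z hz
      have h : z - ζ = ∑ i, a i z • (Pi.single i (1 : ℂ) : Fin m → ℂ) :=
        pi_eq_sum_univ' (z - ζ)
      simp only [Pi.add_apply, b, ← map_smul, ← map_sum, ← h]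
      exact (hW z hz).1.2
    have hcW : AnalyticOnNhd ℂ (fun _ : Fin m → ℂ => f ζ) W := (hconst _).mono hWΩ
    calc φ U f ζ = φ W f ζ := hres U hU hUo W hWU hWo f hf hζW
      _ = φ W ((fun _ => f ζ) + fun z => ∑ i, a i z • b i z) ζ :=
        hlocal W hWΩ hWo _ _ (hf.mono hWU) (hcW.add (hsan _)) heq hζW
      _ = φ W (fun _ => f ζ) ζ + φ W (fun z => ∑ i, a i z • b i z) ζ :=
        hadd W hWΩ hWo _ _ hcW (hsan _) hζW
      _ = φ Ω (fun _ => f ζ) ζ := by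
        rw [hsum, add_zero]
        exact (hres Ω subset_rfl hΩ W hWΩ hWo _ (hconst _) hζW).symm
  let L : (Fin m → ℂ) → E →ₗ[ℂ] F := fun z =>
    if hz : z ∈ Ω then
      { toFun := fun e => φ Ω (fun _ => e) z
        map_add' := fun e e' => hadd Ω subset_rfl hΩ _ _ (hconst e) (hconst e') hz
        map_smul' := fun c e => hsmul Ω subset_rfl hΩ (fun _ => c) _
          (fun _ _ => analyticAt_const) (hconst e) hz }
    else 0
  have hL : ∀ U, U ⊆ Ω → IsOpen U → ∀ f, AnalyticOnNhd ℂ f U → ∀ z ∈ U,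
      φ U f z = L z (f z) := by
    intro U hU hUo f hf z hz
    simp only [L, dif_pos (hU hz)]
    exact hpoint U hU hUo f hf z hz
  obtain ⟨Φ, hΦ, hΦL⟩ := exists_analyticOnNhd_of_linearMap_family hm hΩ (L := L) <| by
    intro ζ hζ f hf
    obtain ⟨W, hW, hWo, hζW⟩ := _root_.eventually_nhds_iff.1
      (hf.eventually_analyticAt.and (hΩ.mem_nhds hζ))
    have hWΩ : W ⊆ Ω := fun z hz => (hW z hz).2
    have hfW : AnalyticOnNhd ℂ f W := fun z hz => (hW z hz).1
    refine (hanal W hWΩ hWo f hfW ζ hζW).congr ?_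
    filter_upwards [hWo.mem_nhds hζW] with z hz using hL W hWΩ hWo f hfW z hz
  refine ⟨Φ, hΦ, fun U hU hUo f hf z hz => ?_⟩
  rw [hL U hU hUo f hf z hz, hΦL z (hU hz)]
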